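/- Let Z and W be Banach spaces such that Z is reflexive and W is separable. If there is a bounded injective linear operator S : Z → W, then Z is separable. -/

import Mathlib

noncomputable section

/-- A normed space is reflexive if the canonical embedding into its bidual is surjective. -/
def IsReflexiveSpace (𝕜 : Type*) [NontriviallyNormedField 𝕜] (Z : Type*)
    [NormedAddCommGroup Z] [NormedSpace 𝕜 Z] : Prop :=
  Function.Surjective (NormedSpace.inclusionInDoubleDual 𝕜 Z)

theorem aux_separable_of_total (𝕜 : Type*) [RCLike 𝕜] (E : Type*)
    [NormedAddCommGroup E] [NormedSpace 𝕜 E] (s : ℕ → E)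
    (h : ∀ f : StrongDual 𝕜 E, (∀ n, f (s n) = 0) → f = 0) :
    TopologicalSpace.SeparableSpace E := by
  set p : Submodule 𝕜 E := (Submodule.span 𝕜 (Set.range s)).topologicalClosure with hp
  have hsp : ∀ n, s n ∈ p := fun n =>
    Submodule.le_topologicalClosure _ (Submodule.subset_span ⟨n, rfl⟩)
  have htop : ∀ x, x ∈ p := by
    intro x
    have hcl : IsClosed (p : Set E) := Submodule.isClosed_topologicalClosure _
    obtain ⟨g, -, hg⟩ := exists_dual_vector'' 𝕜 (p.mkQ x)
    have h0 := h (g.comp p.mkQL) (fun n => by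
      have : p.mkQ (s n) = 0 := by simpa using hsp n
      simp only [ContinuousLinearMap.comp_apply, Submodule.mkQL_apply, this, map_zero])
    have h1 : g (p.mkQ x) = 0 := by
      have := congrArg (fun f : StrongDual 𝕜 E => f x) h0
      simpa using this
    rw [h1] at hg
    have h2 : ‖p.mkQ x‖ = 0 := by exact_mod_cast hg.symm
    have h3 : x ∈ closure (p : Set E) := by
      have := (QuotientAddGroup.norm_mk_eq_zero_iff_mem_closure (S := p.toAddSubgroup) (m := x)).1 h2
      exact this
    rwa [hcl.closure_eq] at h3
  have hs : TopologicalSpace.IsSeparable (Set.univ : Set E) := by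
    have h1 : TopologicalSpace.IsSeparable (Set.range s) :=
      (Set.countable_range s).isSeparable
    have h2 := (h1.span (R := 𝕜)).closure
    exact h2.mono (fun x _ => htop x)
  exact TopologicalSpace.isSeparable_univ_iff.1 hs

theorem aux_separable_of_dual (𝕜 : Type*) [RCLike 𝕜] (E : Type*)
    [NormedAddCommGroup E] [NormedSpace 𝕜 E]
    [TopologicalSpace.SeparableSpace (StrongDual 𝕜 E)] :
    TopologicalSpace.SeparableSpace E := by
  have key : ∀ f : StrongDual 𝕜 E, ∃ x : E, ‖x‖ ≤ 1 ∧ ‖f‖ / 2 ≤ ‖f x‖ := by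
    intro f
    rcases (norm_nonneg f).eq_or_lt with h | h
    · exact ⟨0, by simp, by simp [← h]⟩
    · obtain ⟨x, h1, h2⟩ := f.exists_lt_apply_of_lt_opNorm (half_lt_self h)
      exact ⟨x, h1.le, h2.le⟩
  choose x hx1 hx2 using key
  refine aux_separable_of_total 𝕜 E
    (fun n => x (TopologicalSpace.denseSeq (StrongDual 𝕜 E) n)) fun f hf => ?_
  by_contra hne
  have hpos : 0 < ‖f‖ := norm_pos_iff.2 hne
  obtain ⟨n, hn⟩ := (TopologicalSpace.denseRange_denseSeq (StrongDual 𝕜 E)).exists_dist_lt f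
    (show 0 < ‖f‖ / 4 by positivity)
  have hf := hf n
  generalize TopologicalSpace.denseSeq (StrongDual 𝕜 E) n = g at hn hf
  rw [dist_eq_norm, norm_sub_rev] at hn
  have h1 : ‖g (x g)‖ ≤ ‖g - f‖ := by
    have := (g - f).le_opNorm_of_le (hx1 g)
    simpa [hf] using this
  have h2 := hx2 g
  have h3 : ‖f‖ ≤ ‖g‖ + ‖g - f‖ := by
    have := norm_sub_le g (g - f)
    simpa using this
  linarith

/-- Let `Z` and `W` be Banach spaces with `Z` reflexive and `W` separable.
If there is a bounded injective linear operator `S : Z → W`, then `Z` is separable. -/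
theorem separable_of_reflexive_of_injective_into_separable
    (𝕜 : Type*) [RCLike 𝕜] (Z W : Type*)
    [NormedAddCommGroup Z] [NormedSpace 𝕜 Z] [CompleteSpace Z]
    [NormedAddCommGroup W] [NormedSpace 𝕜 W] [CompleteSpace W]
    (hZ : IsReflexiveSpace 𝕜 Z) (hW : TopologicalSpace.SeparableSpace W)
    (S : Z →L[𝕜] W) (hS : Function.Injective S) :
    TopologicalSpace.SeparableSpace Z := by
  choose g hg1 hg2 using fun w : W => exists_dual_vector'' 𝕜 w
  have : TopologicalSpace.SeparableSpace (StrongDual 𝕜 Z) := by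
    refine aux_separable_of_total 𝕜 (StrongDual 𝕜 Z)
      (fun n => (g (TopologicalSpace.denseSeq W n)).comp S) fun F hF => ?_
    obtain ⟨z, rfl⟩ := hZ F
    suffices hz : S z = 0 by
      have : z = 0 := hS (by simpa using hz)
      simp [this]
    by_contra hne
    have hpos : 0 < ‖S z‖ := norm_pos_iff.2 hne
    obtain ⟨n, hn⟩ := (TopologicalSpace.denseRange_denseSeq W).exists_dist_lt (S z)
      (show 0 < ‖S z‖ / 2 by positivity)
    have hF := hF n
    generalize TopologicalSpace.denseSeq W n = w at hn hF
    rw [NormedSpace.dual_def, ContinuousLinearMap.comp_apply] at hF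
    rw [dist_eq_norm, norm_sub_rev] at hn
    have h1 : ‖w‖ ≤ ‖w - S z‖ := by
      have := (g w).le_of_opNorm_le (hg1 w) (w - S z)
      simpa [hF, hg2 w] using this
    have h3 : ‖S z‖ ≤ ‖w‖ + ‖w - S z‖ := by
      have := norm_sub_le w (w - S z)
      simpa using this
    linarith
  exact aux_separable_of_dual 𝕜 Z
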